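/- The string rewriting system associated to the monoid presentation MP_W is complete: it is terminating (there is no infinite sequence of moves starting from any word in Σ*), and confluent (whenever x →̇ y and x →̇ z, there exists a word w with y →̇ w and z →̇ w). -/

import Mathlib

open SimpleGraph

attribute [local instance] Classical.propDecidable

namespace GraphBraid

/-- The degree of a vertex, defined via `Set.ncard` to avoid decidability assumptions. -/
noncomputable def ncdeg {V : Type} (H : SimpleGraph V) (v : V) : ℕ := (H.neighborSet v).ncard

/-- The basic setup: a finite connected simple graph `G` with a spanning tree `T`,
a root `root` of degree one in `T`, and a labelling of the edges of `T` incident to each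
vertex `u` by the numbers `0, …, d_T(u) - 1`, where the edge towards the root receives the
label `0` (and the unique edge at the root receives the label `1`). -/
structure Setup (V : Type) [Fintype V] [DecidableEq V] where
  G : SimpleGraph V
  G_conn : G.Connected
  T : SimpleGraph V
  T_le : T ≤ G
  T_tree : T.IsTree
  root : V
  root_deg : ncdeg T root = 1
  label : V → V → ℕ
  label_bij : ∀ u : V, u ≠ root → Set.BijOn (label u) (T.neighborSet u) (Set.Iio (ncdeg T u))
  label_zero : ∀ u : V, u ≠ root → ∀ w : V, T.Adj u w →
    (label u w = 0 ↔ T.dist root w + 1 = T.dist root u)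
  label_root : ∀ w : V, T.Adj root w → label root w = 1

namespace Setup

variable {V : Type} [Fintype V] [DecidableEq V] (S : Setup V)

/-- The unique geodesic (path) in the tree `T` from `u` to `w`. -/
noncomputable def geod (u w : V) : S.T.Walk u w := (S.T_tree.existsUnique_path u w).choose

/-- `g(u,w)`: the label at `u` of the first edge of the tree geodesic from `u` to `w`,
with `g(u,u) = 0`. -/
noncomputable def gfun (u w : V) : ℕ :=
  if u = w then 0 else S.label u ((S.geod u w).getVert 1)

lemma exists_wedge (u w : V) :
    ∃ x : V, (x ∈ (S.geod S.root u).support ∧ x ∈ (S.geod S.root w).support) ∧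
      ∀ y : V, y ∈ (S.geod S.root u).support → y ∈ (S.geod S.root w).support →
        S.T.dist S.root y ≤ S.T.dist S.root x := by
  classical
  have hne : ((S.geod S.root u).support.toFinset ∩
      (S.geod S.root w).support.toFinset).Nonempty :=
    ⟨S.root, by simp [SimpleGraph.Walk.start_mem_support]⟩
  obtain ⟨x, hx, hmax⟩ := Finset.exists_max_image _ (fun y => S.T.dist S.root y) hne
  simp only [Finset.mem_inter, List.mem_toFinset] at hx hmax
  exact ⟨x, ⟨hx.1, hx.2⟩, fun y h1 h2 => hmax y ⟨h1, h2⟩⟩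

/-- `u ∧ w`: the vertex farthest from the root lying on both tree geodesics from the
root to `u` and from the root to `w`. -/
noncomputable def wedge (u w : V) : V := (S.exists_wedge u w).choose

/-- The order on vertices: `u ≤ w` iff `u ∧ w = u`, or `u ∧ w ≠ u` and
`g(u ∧ w, u) < g(u ∧ w, w)`. -/
def vle (u w : V) : Prop :=
  S.wedge u w = u ∨ (S.wedge u w ≠ u ∧ S.gfun (S.wedge u w) u < S.gfun (S.wedge u w) w)

/-- The associated strict order on vertices. -/
def vlt (u w : V) : Prop := S.vle u w ∧ u ≠ w

/-- `ι(e)`: the larger endpoint of the edge `e` in the vertex order. -/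
noncomputable def iota (e : Sym2 V) : V :=
  if S.vle (Quot.out e).1 (Quot.out e).2 then (Quot.out e).2 else (Quot.out e).1

/-- `τ(e)`: the smaller endpoint of the edge `e` in the vertex order. -/
noncomputable def tau (e : Sym2 V) : V :=
  if S.vle (Quot.out e).1 (Quot.out e).2 then (Quot.out e).1 else (Quot.out e).2

/-- `e(v)`: the edge of `T` incident to `v` lying on the tree geodesic from `v` to the root. -/
noncomputable def eV (v : V) : Sym2 V := s(v, (S.geod v S.root).getVert 1)

/-- A cell of `UD^n Γ`: an `n`-element set whose elements are vertices (encoded as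
diagonal elements of `Sym2 V`) and closed edges of `G`, no two distinct elements of which
share a vertex. -/
def IsCell (n : ℕ) (c : Finset (Sym2 V)) : Prop :=
  c.card = n ∧ (∀ s ∈ c, s.IsDiag ∨ s ∈ S.G.edgeSet) ∧
    ∀ s ∈ c, ∀ t ∈ c, s ≠ t → ∀ x : V, x ∈ s → x ∉ t

/-- The dimension of a cell: the number of edges it contains. -/
noncomputable def dim (c : Finset (Sym2 V)) : ℕ := (c.filter (fun s => ¬ s.IsDiag)).card

/-- A vertex `v` is blocked in `c` if `v` is the root, or `e(v)` shares a vertex with some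
element of `c` other than `v`. -/
def Blocked (c : Finset (Sym2 V)) (v : V) : Prop :=
  v = S.root ∨ ∃ s ∈ c, s ≠ Sym2.diag v ∧ ∃ x : V, x ∈ S.eV v ∧ x ∈ s

/-- A vertex `v` is unblocked in `c` if it belongs to `c` and is not blocked. -/
def Unblocked (c : Finset (Sym2 V)) (v : V) : Prop := Sym2.diag v ∈ c ∧ ¬ S.Blocked c v

/-- The elementary reduction of `c` from the vertex `v`: replace `v` by the edge `e(v)`. -/
noncomputable def redFrom (c : Finset (Sym2 V)) (v : V) : Finset (Sym2 V) :=
  insert (S.eV v) (c.erase (Sym2.diag v))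

/-- `c'` is the principal elementary reduction of `c`: it is the elementary reduction of `c`
from the smallest unblocked vertex of `c`. -/
def PrincipalRedOf (c c' : Finset (Sym2 V)) : Prop :=
  ∃ v : V, S.Unblocked c v ∧ (∀ u : V, S.Unblocked c u → S.vle v u) ∧ c' = S.redFrom c v

/-- Auxiliary definition of redundancy, by induction on the dimension: a cell of
dimension `i` is redundant iff it has an unblocked vertex and it is not the principal
elementary reduction of a redundant cell of dimension `i - 1`. -/
def RedundantAux (n : ℕ) : ℕ → Finset (Sym2 V) → Prop
  | 0, c => ∃ v, S.Unblocked c v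
  | (i + 1), c => (∃ v, S.Unblocked c v) ∧
      ¬ ∃ c₀, S.IsCell n c₀ ∧ dim c₀ = i ∧ RedundantAux n i c₀ ∧ S.PrincipalRedOf c₀ c

/-- A cell is redundant if the discrete vector field `W` is defined on it. -/
def Redundant (n : ℕ) (c : Finset (Sym2 V)) : Prop := S.RedundantAux n (dim c) c

/-- A cell is collapsible if it lies in the image of `W`. -/
def Collapsible (n : ℕ) (c : Finset (Sym2 V)) : Prop :=
  ∃ c₀, S.IsCell n c₀ ∧ S.Redundant n c₀ ∧ S.PrincipalRedOf c₀ c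

/-- A cell is critical if it is neither redundant nor collapsible. -/
def Critical (n : ℕ) (c : Finset (Sym2 V)) : Prop :=
  ¬ S.Redundant n c ∧ ¬ S.Collapsible n c

/-- An edge `e` of the cell `c` is order-respecting in `c` if `e` lies in `T` and every
vertex `v ∈ c` such that `e(v)` and `e` share the vertex `τ(e)` satisfies `v > ι(e)`. -/
def OrderResp (c : Finset (Sym2 V)) (e : Sym2 V) : Prop :=
  e ∈ c ∧ e ∈ S.T.edgeSet ∧
    ∀ v : V, v ≠ S.root → Sym2.diag v ∈ c → S.tau e ∈ S.eV v → S.vlt (S.iota e) v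

/-- `e` is the minimal order-respecting edge of `c`. -/
def MinOrderResp (c : Finset (Sym2 V)) (e : Sym2 V) : Prop :=
  S.OrderResp c e ∧ ∀ e' : Sym2 V, S.OrderResp c e' → S.vle (S.iota e) (S.iota e')

/-- `c'` is a face of `c` obtained by replacing one edge of `c` by one of its endpoints. -/
def IsFace (c' c : Finset (Sym2 V)) : Prop :=
  ∃ (e : Sym2 V) (x : V), e ∈ c ∧ ¬ e.IsDiag ∧ x ∈ e ∧ c' = insert (Sym2.diag x) (c.erase e)

/-- `Γ` is sufficiently subdivided for `n`: every path between distinct vertices of degree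
`≠ 2` passes through at least `n - 1` edges, and every cycle has length at least `n + 1`. -/
def SuffSubdiv (n : ℕ) : Prop :=
  (∀ u v : V, u ≠ v → ncdeg S.G u ≠ 2 → ncdeg S.G v ≠ 2 →
    ∀ p : S.G.Walk u v, p.IsPath → n - 1 ≤ p.length) ∧
  (∀ v : V, ∀ p : S.G.Walk v v, p.IsCycle → n + 1 ≤ p.length)

end Setup

/-- Reversal of orientation of an oriented 1-cell. -/
def bar {V : Type} (a : Finset (Sym2 V) × Bool) : Finset (Sym2 V) × Bool := (a.1, !a.2)

/-- The formal inverse of a word of oriented 1-cells. -/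
def wordInv {V : Type} (w : List (Finset (Sym2 V) × Bool)) : List (Finset (Sym2 V) × Bool) :=
  (w.map bar).reverse

namespace Setup

variable {V : Type} [Fintype V] [DecidableEq V] (S : Setup V)

/-- The unique edge of a 1-cell (with a junk value if the cell contains no edge). -/
noncomputable def theEdge (c : Finset (Sym2 V)) : Sym2 V :=
  if h : (c.filter (fun s => ¬ s.IsDiag)).Nonempty then h.choose else Sym2.diag S.root

/-- The source 0-cell of an oriented 1-cell: a positively oriented 1-cell runs from the
0-cell obtained by replacing its edge `e` with `ι(e)` to the one obtained by replacing `e`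
with `τ(e)`. -/
noncomputable def src (a : Finset (Sym2 V) × Bool) : Finset (Sym2 V) :=
  insert (Sym2.diag (if a.2 then S.iota (S.theEdge a.1) else S.tau (S.theEdge a.1)))
    (a.1.erase (S.theEdge a.1))

/-- The target 0-cell of an oriented 1-cell. -/
noncomputable def tgt (a : Finset (Sym2 V) × Bool) : Finset (Sym2 V) :=
  insert (Sym2.diag (if a.2 then S.tau (S.theEdge a.1) else S.iota (S.theEdge a.1)))
    (a.1.erase (S.theEdge a.1))

/-- `w` is a boundary word of the 2-cell `σ`: a closed loop of length 4 in the 1-skeleton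
reading the four faces of `σ`, each with the orientation induced by the traversal. -/
def IsBoundaryWord (n : ℕ) (σ : Finset (Sym2 V)) (w : List (Finset (Sym2 V) × Bool)) : Prop :=
  ∃ a b c d : Finset (Sym2 V) × Bool, w = [a, b, c, d] ∧
    S.tgt a = S.src b ∧ S.tgt b = S.src c ∧ S.tgt c = S.src d ∧ S.tgt d = S.src a ∧
    ([a.1, b.1, c.1, d.1] : List (Finset (Sym2 V))).Nodup ∧
    (∀ x ∈ [a, b, c, d], S.IsCell n x.1 ∧ dim x.1 = 1) ∧
    (∀ c' : Finset (Sym2 V), IsFace c' σ ↔ c' ∈ [a.1, b.1, c.1, d.1])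

end Setup

/-- The relations of the monoid presentation `MP_W`: collapsible 1-cells are trivial, free
reduction, and each collapsible 2-cell `σ = W(c₀)` gives relations `(a, w̄)` and `(ā, w)`
for a boundary word `a·w` of `σ` starting with an orientation `a` of `c₀`. -/
inductive MPRel {V : Type} [Fintype V] [DecidableEq V] (S : Setup V) (n : ℕ) :
    List (Finset (Sym2 V) × Bool) → List (Finset (Sym2 V) × Bool) → Prop
  | collapse (a : Finset (Sym2 V) × Bool) (h1 : S.IsCell n a.1) (h2 : Setup.dim a.1 = 1)
      (h3 : S.Collapsible n a.1) : MPRel S n [a] []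
  | cancel (a : Finset (Sym2 V) × Bool) (h1 : S.IsCell n a.1) (h2 : Setup.dim a.1 = 1) :
      MPRel S n [a, bar a] []
  | square (σ c₀ : Finset (Sym2 V)) (a : Finset (Sym2 V) × Bool)
      (w : List (Finset (Sym2 V) × Bool)) (hσ : S.IsCell n σ) (hd : Setup.dim σ = 2)
      (hc₀ : S.IsCell n c₀) (hred : S.Redundant n c₀) (hW : S.PrincipalRedOf c₀ σ)
      (ha : a.1 = c₀) (hbw : S.IsBoundaryWord n σ (a :: w)) (hno : ∀ x ∈ w, x.1 ≠ c₀) :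
      MPRel S n [a] (wordInv w)
  | squareInv (σ c₀ : Finset (Sym2 V)) (a : Finset (Sym2 V) × Bool)
      (w : List (Finset (Sym2 V) × Bool)) (hσ : S.IsCell n σ) (hd : Setup.dim σ = 2)
      (hc₀ : S.IsCell n c₀) (hred : S.Redundant n c₀) (hW : S.PrincipalRedOf c₀ σ)
      (ha : a.1 = c₀) (hbw : S.IsBoundaryWord n σ (a :: w)) (hno : ∀ x ∈ w, x.1 ≠ c₀) :
      MPRel S n [bar a] w

/-- A single move of the string rewriting system associated to `MP_W`. -/
def MPMove {V : Type} [Fintype V] [DecidableEq V] (S : Setup V) (n : ℕ)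
    (x y : List (Finset (Sym2 V) × Bool)) : Prop :=
  ∃ u v r₁ r₂ : List (Finset (Sym2 V) × Bool),
    MPRel S n r₁ r₂ ∧ x = u ++ r₁ ++ v ∧ y = u ++ r₂ ++ v

namespace Setup

section Tree

variable {V : Type} [Fintype V] [DecidableEq V] (S : Setup V)

lemma geod_path (u w : V) : (S.geod u w).IsPath := (S.T_tree.existsUnique_path u w).choose_spec.1

lemma geod_unique {u w : V} (p : S.T.Walk u w) (hp : p.IsPath) : p = S.geod u w :=
  (S.T_tree.existsUnique_path u w).choose_spec.2 p hp

lemma geod_length (u w : V) : (S.geod u w).length = S.T.dist u w := by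
  obtain ⟨p, hp, hl⟩ := S.T_tree.connected.exists_path_of_dist u w
  rw [← S.geod_unique p hp, hl]

/-- The list of labels read along the geodesic from the root. -/
noncomputable def lab {u w : V} (p : S.T.Walk u w) : List ℕ :=
  p.darts.map (fun d => S.label d.fst d.snd)

noncomputable def key (v : V) : List ℕ := S.lab (S.geod S.root v)

lemma geod_split (x u : V) (hx : x ∈ (S.geod S.root u).support) :
    S.geod S.root u = (S.geod S.root x).append (S.geod x u) := by
  have h := (S.geod S.root u).take_spec hx
  have h1 := S.geod_unique _ ((S.geod_path S.root u).takeUntil hx)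
  have h2 := S.geod_unique _ ((S.geod_path S.root u).dropUntil hx)
  rw [h1, h2] at h
  exact h.symm

lemma key_split (x u : V) (hx : x ∈ (S.geod S.root u).support) :
    S.key u = S.key x ++ S.lab (S.geod x u) := by
  unfold key lab
  rw [S.geod_split x u hx, SimpleGraph.Walk.darts_append, List.map_append]

lemma lab_self (x : V) : S.lab (S.geod x x) = [] := by
  rw [← S.geod_unique (SimpleGraph.Walk.nil : S.T.Walk x x) SimpleGraph.Walk.IsPath.nil]
  rfl

lemma lab_ne (x u : V) (h : x ≠ u) : ∃ A, S.lab (S.geod x u) = S.gfun x u :: A := by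
  unfold gfun
  rw [if_neg h]
  generalize S.geod x u = p
  cases p with
  | nil => exact absurd rfl h
  | cons hadj q => exact ⟨S.lab q, by simp [lab]⟩

lemma next_info (x u : V) (hx : x ∈ (S.geod S.root u).support) (h : x ≠ u) :
    S.T.Adj x ((S.geod x u).getVert 1) ∧
      (S.geod x u).getVert 1 ∈ (S.geod S.root u).support ∧
      S.T.dist S.root x < S.T.dist S.root ((S.geod x u).getVert 1) := by
  have hs := S.geod_split x u hx
  have hl := S.geod_length S.root u
  have hlx := S.geod_length S.root x
  rw [hs] at hl ⊢
  generalize S.geod x u = p at *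
  cases p with
  | nil => exact absurd rfl h
  | @cons _ y _ hadj q =>
    have h3 := S.T_tree.connected.dist_triangle (u := S.root) (v := y) (w := u)
    have h4 := SimpleGraph.dist_le q
    simp at hl
    refine ⟨by simpa using hadj, by simp [SimpleGraph.Walk.mem_support_append_iff], ?_⟩
    simp
    omega

lemma gfun_ne (u w : V) (hu : S.wedge u w ≠ u) (hw : S.wedge u w ≠ w) :
    S.gfun (S.wedge u w) u ≠ S.gfun (S.wedge u w) w := by
  obtain ⟨⟨h1, h2⟩, h3⟩ := (S.exists_wedge u w).choose_spec
  change S.wedge u w ∈ _ at h1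
  change S.wedge u w ∈ _ at h2
  change ∀ y, _ → _ → _ ≤ S.T.dist S.root (S.wedge u w) at h3
  generalize S.wedge u w = x at *
  intro he
  unfold gfun at he
  rw [if_neg hu, if_neg hw] at he
  obtain ⟨a1, a2, a3⟩ := S.next_info x u h1 hu
  obtain ⟨b1, b2, b3⟩ := S.next_info x w h2 hw
  have : (S.geod x u).getVert 1 = (S.geod x w).getVert 1 := by
    by_cases hr : x = S.root
    · have hd := S.root_deg
      unfold ncdeg at hd
      rw [Set.ncard_eq_one] at hd
      obtain ⟨z, hz⟩ := hd
      subst hr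
      have e1 : (S.geod S.root u).getVert 1 ∈ S.T.neighborSet S.root := a1
      have e2 : (S.geod S.root w).getVert 1 ∈ S.T.neighborSet S.root := b1
      rw [hz] at e1 e2
      exact e1.trans e2.symm
    · exact (S.label_bij x hr).injOn a1 b1 he
  rw [← this] at b2
  have := h3 _ a2 b2
  omega

lemma wedge_keys (u w : V) : ∃ K A B : List ℕ, S.key u = K ++ A ∧ S.key w = K ++ B ∧
    ((S.wedge u w = u ∧ A = []) ∨
      (S.wedge u w ≠ u ∧ ∃ A', A = S.gfun (S.wedge u w) u :: A')) ∧
    ((S.wedge u w = w ∧ B = []) ∨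
      (S.wedge u w ≠ w ∧ ∃ B', B = S.gfun (S.wedge u w) w :: B')) := by
  obtain ⟨⟨h1, h2⟩, -⟩ := (S.exists_wedge u w).choose_spec
  refine ⟨_, _, _, S.key_split _ u h1, S.key_split _ w h2, ?_, ?_⟩
  · change (S.wedge u w = u ∧ S.lab (S.geod (S.wedge u w) u) = []) ∨
      (S.wedge u w ≠ u ∧ ∃ A', S.lab (S.geod (S.wedge u w) u) = _)
    generalize S.wedge u w = x
    by_cases h : x = u
    · subst h; left; exact ⟨rfl, S.lab_self _⟩
    · right; exact ⟨h, S.lab_ne _ _ h⟩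
  · change (S.wedge u w = w ∧ S.lab (S.geod (S.wedge u w) w) = []) ∨
      (S.wedge u w ≠ w ∧ ∃ A', S.lab (S.geod (S.wedge u w) w) = _)
    generalize S.wedge u w = x
    by_cases h : x = w
    · subst h; left; exact ⟨rfl, S.lab_self _⟩
    · right; exact ⟨h, S.lab_ne _ _ h⟩

lemma key_inj {u w : V} (h : S.key u = S.key w) : u = w := by
  obtain ⟨K, A, B, hA, hB, h1, h2⟩ := S.wedge_keys u w
  have hAB : A = B := by
    rw [hA, hB] at h
    exact List.append_cancel_left h
  rcases h1 with ⟨h1, rfl⟩ | ⟨h1, A', rfl⟩ <;> rcases h2 with ⟨h2, rfl⟩ | ⟨h2, B', rfl⟩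
  · exact h1.symm.trans h2
  · simp at hAB
  · simp at hAB
  · simp at hAB
    exact absurd hAB.1 (S.gfun_ne u w h1 h2)

lemma gfun_self (u : V) : S.gfun u u = 0 := by simp [gfun]

lemma vle_iff (u w : V) : S.vle u w ↔ ¬ S.key w < S.key u := by
  obtain ⟨K, A, B, hA, hB, h1, h2⟩ := S.wedge_keys u w
  rw [hA, hB]
  have happ : K ++ B < K ++ A ↔ B < A := by
    constructor
    · intro h
      by_contra h'
      rcases lt_or_eq_of_le (not_lt.mp h') with h'' | h''
      · exact lt_asymm h (List.append_left_lt h'')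
      · rw [h''] at h; exact lt_irrefl _ h
    · exact List.append_left_lt
  rw [happ]
  unfold vle
  rcases h1 with ⟨h1, rfl⟩ | ⟨h1, A', rfl⟩
  · simp [h1]
  · rcases h2 with ⟨h2, rfl⟩ | ⟨h2, B', rfl⟩
    · have : S.gfun w w = 0 := S.gfun_self w
      simp [h2, this]
      intro h; exact h1 (h2.trans h)
    · have := S.gfun_ne u w h1 h2
      simp only [h1, false_or, ne_eq, not_false_eq_true, true_and, List.cons_lt_cons_iff]
      omega

lemma vle_antisymm {u w : V} (h1 : S.vle u w) (h2 : S.vle w u) : u = w := by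
  rw [vle_iff] at h1 h2
  exact S.key_inj (le_antisymm (not_lt.mp h1) (not_lt.mp h2))

/-- Position in the vertex order. -/
noncomputable def pos (v : V) : ℕ := (Finset.univ.filter (fun u => S.key u < S.key v)).card

lemma pos_lt {u w : V} (h : ¬ S.vle w u) : S.pos u < S.pos w := by
  rw [vle_iff, not_not] at h
  apply Finset.card_lt_card
  rw [Finset.ssubset_iff_of_subset]
  · exact ⟨u, by simpa using h, by simp⟩
  · intro x hx
    simp at hx ⊢
    exact hx.trans h

lemma pos_le {u w : V} (h : S.vle u w) : S.pos u ≤ S.pos w := by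
  rw [vle_iff] at h
  apply Finset.card_le_card
  intro x hx
  simp at hx ⊢
  exact lt_of_lt_of_le hx (not_lt.mp h)

/-- Distance from the root. -/
noncomputable def depth (v : V) : ℕ := S.T.dist S.root v

/-- Parent of a vertex. -/
noncomputable def par (v : V) : V := (S.geod v S.root).getVert 1

lemma eV_def (v : V) : S.eV v = s(v, S.par v) := rfl

lemma par_info {v : V} (h : v ≠ S.root) : S.T.Adj v (S.par v) ∧ S.depth v = S.depth (S.par v) + 1 := by
  have hl := S.geod_length v S.root
  unfold par depth
  rw [SimpleGraph.dist_comm, ← hl, SimpleGraph.dist_comm]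
  have hp := S.geod_path v S.root
  generalize S.geod v S.root = p at *
  cases p with
  | nil => exact absurd rfl h
  | @cons _ y _ hadj q =>
    refine ⟨by simpa using hadj, ?_⟩
    have := S.geod_unique q (hp.of_cons)
    have h2 := S.geod_length y S.root
    rw [← this] at h2
    simp [h2]

lemma tree_edge {e : Sym2 V} (he : e ∈ S.T.edgeSet) : ∃ w, w ≠ S.root ∧ e = S.eV w := by
  have key : ∀ a b : V, S.T.Adj a b → S.T.dist S.root a = S.T.dist S.root b + 1 →
      a ≠ S.root ∧ s(a, b) = S.eV a := by
    intro a b hab hd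
    have hne : a ≠ S.root := by
      rintro rfl
      simp at hd
    refine ⟨hne, ?_⟩
    have hp : (SimpleGraph.Walk.cons hab (S.geod b S.root)).IsPath := by
      apply SimpleGraph.Walk.isPath_of_length_eq_dist
      rw [SimpleGraph.Walk.length_cons, S.geod_length, SimpleGraph.dist_comm, ← hd,
        SimpleGraph.dist_comm]
    have := S.geod_unique _ hp
    rw [eV_def, par, ← this]
    simp
  induction e using Sym2.ind with
  | _ a b =>
    have hab : S.T.Adj a b := he
    rcases S.T_tree.dist_eq_dist_add_one_of_adj S.root hab with h | h
    · exact ⟨a, key a b hab h⟩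
    · obtain ⟨h1, h2⟩ := key b a hab.symm h
      exact ⟨b, h1, by rw [← h2, Sym2.eq_swap]⟩

lemma eV_inj {u v : V} (hu : u ≠ S.root) (hv : v ≠ S.root) (h : S.eV u = S.eV v) : u = v := by
  have h1 := (S.par_info hu).2
  have h2 := (S.par_info hv).2
  rw [eV_def, eV_def, Sym2.eq_iff] at h
  rcases h with ⟨h, -⟩ | ⟨h, h'⟩
  · exact h
  · rw [h'] at h1
    rw [← h] at h2
    omega

lemma eV_not_diag {v : V} (h : v ≠ S.root) : ¬ (S.eV v).IsDiag := by
  rw [eV_def, Sym2.mk_isDiag_iff]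
  exact (S.par_info h).1.ne

end Tree

end Setup

namespace Setup

section Cells

variable {V : Type} [Fintype V] [DecidableEq V] (S : Setup V)

lemma mem_dg {y v : V} : y ∈ Sym2.diag v ↔ y = v := by
  simp [Sym2.diag]

lemma dg_isDiag (v : V) : (Sym2.diag v).IsDiag := by simp

lemma dg_inj {u v : V} (h : Sym2.diag u = Sym2.diag v) : u = v := by
  have : u ∈ Sym2.diag v := h ▸ mem_dg.2 rfl
  exact mem_dg.1 this

/-- Largest depth of an endpoint. -/
noncomputable def hgt (s : Sym2 V) : ℕ :=
  Sym2.lift ⟨fun a b => max (S.depth a) (S.depth b), fun a b => max_comm _ _⟩ s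

lemma hgt_diag (v : V) : S.hgt (Sym2.diag v) = S.depth v := by
  simp [hgt, Sym2.diag]

lemma hgt_eV {v : V} (h : v ≠ S.root) : S.hgt (S.eV v) = S.depth v := by
  have := (S.par_info h).2
  simp [hgt, eV_def]
  omega

lemma mem_eV {y v : V} : y ∈ S.eV v ↔ y = v ∨ y = S.par v := by
  simp [eV_def]

noncomputable def Dsum (c : Finset (Sym2 V)) : ℕ := ∑ s ∈ c, S.hgt s

lemma Dsum_insert_le (s : Sym2 V) (c : Finset (Sym2 V)) :
    S.Dsum (insert s c) ≤ S.hgt s + S.Dsum c := by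
  unfold Dsum
  by_cases h : s ∈ c
  · rw [Finset.insert_eq_of_mem h]; omega
  · rw [Finset.sum_insert h]

lemma Dsum_erase {s : Sym2 V} {c : Finset (Sym2 V)} (h : s ∈ c) :
    S.Dsum c = S.hgt s + S.Dsum (c.erase s) :=
  (Finset.add_sum_erase c _ h).symm

/-- A 1-cell has a unique edge. -/
lemma edge_of_dim_one {c : Finset (Sym2 V)} (h : dim c = 1) :
    ∃ e, e ∈ c ∧ ¬ e.IsDiag ∧ ∀ s ∈ c, ¬ s.IsDiag → s = e := by
  unfold dim at h
  obtain ⟨e, he⟩ := Finset.card_eq_one.1 h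
  have h1 : e ∈ c.filter (fun s => ¬ s.IsDiag) := by rw [he]; simp
  rw [Finset.mem_filter] at h1
  refine ⟨e, h1.1, h1.2, fun s hs hd => ?_⟩
  have : s ∈ c.filter (fun s => ¬ s.IsDiag) := Finset.mem_filter.2 ⟨hs, hd⟩
  rw [he] at this
  simpa using this

def HasDel (c : Finset (Sym2 V)) : Prop := ∃ s ∈ c, ¬ s.IsDiag ∧ s ∉ S.T.edgeSet

def HasSmall (c : Finset (Sym2 V)) : Prop :=
  ∃ u w : V, S.Unblocked c u ∧ w ≠ S.root ∧ S.eV w ∈ c ∧ ¬ S.vle w u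

noncomputable def topPos (c : Finset (Sym2 V)) : ℕ :=
  ∑ w ∈ Finset.univ.filter (fun w => w ≠ S.root ∧ S.eV w ∈ c), S.pos w

lemma topPos_eq {c : Finset (Sym2 V)} {w : V} (hw : w ≠ S.root) (he : S.eV w ∈ c)
    (hu : ∀ s ∈ c, ¬ s.IsDiag → s = S.eV w) : S.topPos c = S.pos w := by
  unfold topPos
  have : Finset.univ.filter (fun w => w ≠ S.root ∧ S.eV w ∈ c) = {w} := by
    ext x
    simp only [Finset.mem_filter, Finset.mem_univ, true_and, Finset.mem_singleton]
    constructor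
    · rintro ⟨h1, h2⟩
      exact S.eV_inj h1 hw (hu _ h2 (S.eV_not_diag h1))
    · rintro rfl
      exact ⟨hw, he⟩
  rw [this, Finset.sum_singleton]

noncomputable def rk (n : ℕ) (c : Finset (Sym2 V)) : ℕ ×ₗ ℕ ×ₗ ℕ ×ₗ ℕ ×ₗ ℕ :=
  toLex (if S.Redundant n c then 1 else 0, toLex (if S.HasDel c then 1 else 0,
    toLex (S.Dsum c, toLex (if S.HasSmall c then 0 else 1, S.topPos c))))

/-- One step along a gradient path. -/
def GStep (n : ℕ) (c' c : Finset (Sym2 V)) : Prop :=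
  S.IsCell n c ∧ dim c = 1 ∧ S.Redundant n c ∧ ∃ σ, S.PrincipalRedOf c σ ∧ IsFace c' σ ∧
    c' ≠ c ∧ S.IsCell n c' ∧ dim c' = 1

lemma vle_refl (v : V) : S.vle v v := by rw [vle_iff]; exact lt_irrefl _

/-- The essential case: `C` is the upper 0-cell. -/
lemma small_of_redundant {n : ℕ} {c R : Finset (Sym2 V)} {v w : V}
    (hc : S.IsCell n c) (hv : S.Unblocked c v) (hmin : ∀ u : V, S.Unblocked c u → S.vle v u)
    (hw : w ≠ S.root) (he : S.eV w ∈ c) (hed : ∀ s ∈ c, ¬ s.IsDiag → s = S.eV w)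
    (hR : R = (c.erase (Sym2.diag v)).erase (S.eV w))
    (hdim : dim (insert (Sym2.diag w) (insert (S.eV v) R)) = 1)
    (hred : S.Redundant n (insert (Sym2.diag w) (insert (S.eV v) R))) :
    S.HasSmall (insert (Sym2.diag w) (insert (S.eV v) R)) := by
  obtain ⟨hvc, hvb⟩ := hv
  have hvr : v ≠ S.root := fun h => hvb (Or.inl h)
  have hvs : ∀ s ∈ c, s ≠ Sym2.diag v → ∀ x, x ∈ S.eV v → x ∉ s := by
    intro s hs hne x hx hxs
    exact hvb (Or.inr ⟨s, hs, hne, x, hx, hxs⟩)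
  have hwd := S.eV_not_diag hw
  have hewne : ∀ u, S.eV w ≠ Sym2.diag u := fun u h => hwd (h ▸ dg_isDiag u)
  have hwe : w ∈ S.eV w := S.mem_eV.2 (Or.inl rfl)
  have hve : ∀ x, x ∈ S.eV v → x ∉ S.eV w := hvs _ he (hewne v)
  have hvw : v ≠ w := by
    rintro rfl
    exact hve v hwe hwe
  have hRc : ∀ s ∈ R, s ∈ c := by
    intro s hs
    rw [hR] at hs
    exact Finset.mem_of_mem_erase (Finset.mem_of_mem_erase hs)
  have hRv : Sym2.diag v ∉ R := by rw [hR]; simp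
  have hRe : S.eV w ∉ R := by rw [hR]; simp
  have hRw : ∀ s ∈ R, w ∉ s := by
    intro s hs hws
    have hne : s ≠ S.eV w := fun h => hRe (h ▸ hs)
    exact hc.2.2 s (hRc s hs) _ he hne w hws hwe
  have hcR : ∀ s ∈ c, s = Sym2.diag v ∨ s = S.eV w ∨ s ∈ R := by
    intro s hs
    rw [hR]
    simp only [Finset.mem_erase]
    tauto
  -- the 0-cell
  set C : Finset (Sym2 V) := insert (Sym2.diag v) (insert (Sym2.diag w) R) with hC
  have hdwR : Sym2.diag w ∉ R := fun h => hRw _ h (mem_dg.2 rfl)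
  have hdvw : Sym2.diag v ≠ Sym2.diag w := fun h => hvw (dg_inj h)
  have hevR : S.eV v ∉ R := by
    intro h
    exact hvs _ (hRc _ h) (fun h' => S.eV_not_diag hvr (h' ▸ dg_isDiag v)) v
      (S.mem_eV.2 (Or.inl rfl)) (S.mem_eV.2 (Or.inl rfl))
  have hCmem : ∀ s, s ∈ C ↔ s = Sym2.diag v ∨ s = Sym2.diag w ∨ s ∈ R := by
    intro s; rw [hC]; simp only [Finset.mem_insert]
  have hRdiag : ∀ s ∈ R, s.IsDiag := by
    intro s hs
    by_contra hd
    exact hRe (hed s (hRc s hs) hd ▸ hs)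
  have hCcell : S.IsCell n C := by
    refine ⟨?_, ?_, ?_⟩
    · have h1 : R.card + 1 + 1 = n := by
        rw [← hc.1, hR]
        have h2 : S.eV w ∈ c.erase (Sym2.diag v) := Finset.mem_erase.2 ⟨hewne v, he⟩
        rw [Finset.card_erase_add_one h2, Finset.card_erase_add_one hvc]
      rw [hC, Finset.card_insert_of_notMem (by simp [hdvw, hRv]), Finset.card_insert_of_notMem hdwR, h1]
    · intro s hs
      left
      rcases (hCmem s).1 hs with rfl | rfl | h
      · exact dg_isDiag _
      · exact dg_isDiag _
      · exact hRdiag s h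
    · intro s hs t ht hne x hxs hxt
      rcases (hCmem s).1 hs with rfl | rfl | h <;> rcases (hCmem t).1 ht with rfl | rfl | h'
      · exact hne rfl
      · exact hvw ((mem_dg.1 hxs).symm.trans (mem_dg.1 hxt))
      · exact hc.2.2 _ hvc t (hRc t h') hne x hxs hxt
      · exact hvw ((mem_dg.1 hxt).symm.trans (mem_dg.1 hxs))
      · exact hne rfl
      · rw [mem_dg.1 hxs] at hxt; exact hRw t h' hxt
      · exact hc.2.2 s (hRc s h) _ hvc hne x hxs hxt
      · rw [mem_dg.1 hxt] at hxs; exact hRw s h hxs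
      · exact hc.2.2 s (hRc s h) t (hRc t h') hne x hxs hxt
  have hCdim : dim C = 0 := by
    unfold dim
    rw [Finset.card_eq_zero, Finset.filter_eq_empty_iff]
    intro s hs
    rw [not_not]
    rcases (hCmem s).1 hs with rfl | rfl | h
    · exact dg_isDiag _
    · exact dg_isDiag _
    · exact hRdiag s h
  have hCv : S.Unblocked C v := by
    refine ⟨(hCmem _).2 (Or.inl rfl), ?_⟩
    rintro (h | ⟨s, hs, hne, x, hx, hxs⟩)
    · exact hvr h
    · rcases (hCmem s).1 hs with rfl | rfl | h
      · exact hne rfl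
      · rw [mem_dg.1 hxs] at hx
        exact hve w hx hwe
      · exact hvs s (hRc s h) hne x hx hxs
  have hredC : insert (Sym2.diag w) (insert (S.eV v) R) = S.redFrom C v := by
    unfold redFrom
    rw [hC, Finset.erase_insert (by simp [hdvw, hRv]), Finset.insert_comm]
  set c' := insert (Sym2.diag w) (insert (S.eV v) R) with hc'
  have hex : ∃ u, S.Unblocked C u ∧ ¬ S.vle v u := by
    by_contra hcon
    push Not at hcon
    unfold Redundant at hred
    rw [hdim] at hred
    exact hred.2 ⟨C, hCcell, hCdim, ⟨v, hCv⟩, v, hCv, hcon, hredC⟩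
  obtain ⟨u, ⟨huC, hub⟩, hvu⟩ := hex
  have huv : u ≠ v := by
    rintro rfl
    exact hvu (S.vle_refl u)
  have hus : ∀ s ∈ C, s ≠ Sym2.diag u → ∀ x, x ∈ S.eV u → x ∉ s := by
    intro s hs hne x hx hxs
    exact hub (Or.inr ⟨s, hs, hne, x, hx, hxs⟩)
  have hur : u ≠ S.root := fun h => hub (Or.inl h)
  have huw : u = w ∨ Sym2.diag u ∈ R := by
    rcases (hCmem _).1 huC with h | h | h
    · exact absurd (dg_inj h) huv
    · exact Or.inl (dg_inj h)
    · exact Or.inr h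
  have hmem' : ∀ s, s ∈ c' ↔ s = Sym2.diag w ∨ s = S.eV v ∨ s ∈ R := by
    intro s; rw [hc']; simp only [Finset.mem_insert]
  refine ⟨u, v, ⟨?_, ?_⟩, hvr, (hmem' _).2 (Or.inr (Or.inl rfl)), hvu⟩
  · rcases huw with rfl | h
    · exact (hmem' _).2 (Or.inl rfl)
    · exact (hmem' _).2 (Or.inr (Or.inr h))
  · rintro (h | ⟨s, hs, hne, y, hy, hys⟩)
    · exact hur h
    · rcases (hmem' s).1 hs with rfl | rfl | h
      · exact hus _ ((hCmem _).2 (Or.inr (Or.inl rfl))) hne y hy hys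
      · -- `y ∈ e(u) ∩ e(v)`
        rcases huw with rfl | hu
        · exact hve y hys hy
        · have huc := hRc _ hu
          rcases S.mem_eV.1 hy with rfl | rfl
          · exact hvs _ huc (fun h => huv (dg_inj h)) y hys (mem_dg.2 rfl)
          · refine hvu (hmin u ⟨huc, ?_⟩)
            rintro (h | ⟨s, hs, hne', z, hz, hzs⟩)
            · exact hur h
            · rcases hcR s hs with rfl | rfl | h
              · exact hus _ ((hCmem _).2 (Or.inl rfl)) hne' z hz hzs
              · rcases S.mem_eV.1 hz with rfl | rfl
                · exact hc.2.2 _ huc _ he (hewne _).symm z (mem_dg.2 rfl) hzs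
                · exact hve _ hys hzs
              · exact hus _ ((hCmem _).2 (Or.inr (Or.inr h))) hne' z hz hzs
      · exact hus _ ((hCmem _).2 (Or.inr (Or.inr h))) hne y hy hys

lemma gstep_rk {n : ℕ} {c' c : Finset (Sym2 V)} (h : S.GStep n c' c) : S.rk n c' < S.rk n c := by
  obtain ⟨hc, hdim, hred, σ, ⟨v, hv, hmin, rfl⟩, ⟨e', x, he', hde', hx, hface⟩, hne, hc', hdim'⟩ := h
  obtain ⟨e, hec, hed, heu⟩ := edge_of_dim_one hdim
  have hvb := hv.2
  have hvc := hv.1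
  have hvr : v ≠ S.root := fun h => hvb (Or.inl h)
  have hvs : ∀ s ∈ c, s ≠ Sym2.diag v → ∀ x, x ∈ S.eV v → x ∉ s := by
    intro s hs hne x hx hxs
    exact hvb (Or.inr ⟨s, hs, hne, x, hx, hxs⟩)
  have hevd := S.eV_not_diag hvr
  have hevc : S.eV v ∉ c := by
    intro h
    exact hvs _ h (fun h' => hevd (h' ▸ dg_isDiag v)) v
      (S.mem_eV.2 (Or.inl rfl)) (S.mem_eV.2 (Or.inl rfl))
  have hDc := S.Dsum_erase hvc
  rw [S.hgt_diag] at hDc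
  have hpar := (S.par_info hvr).2
  unfold rk
  simp only [Prod.Lex.toLex_lt_toLex, hred, if_true]
  by_cases hred' : S.Redundant n c'
  swap
  · left; simp [hred']
  right
  refine ⟨by simp [hred'], ?_⟩
  unfold redFrom at he' hface
  by_cases hcase : e' = S.eV v
  · subst hcase
    rw [Finset.erase_insert (fun h => hevc (Finset.mem_of_mem_erase h))] at hface
    rcases S.mem_eV.1 hx with rfl | rfl
    · rw [Finset.insert_erase hvc] at hface
      exact absurd hface hne
    · have hD : S.Dsum c' < S.Dsum c := by
        have := S.Dsum_insert_le (Sym2.diag (S.par v)) (c.erase (Sym2.diag v))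
        rw [← hface, S.hgt_diag] at this
        omega
      have hdel : S.HasDel c' → S.HasDel c := by
        rintro ⟨s, hs, h1, h2⟩
        rw [hface, Finset.mem_insert, Finset.mem_erase] at hs
        rcases hs with rfl | hs
        · exact absurd (dg_isDiag _) h1
        · exact ⟨s, hs.2, h1, h2⟩
      by_cases h1 : S.HasDel c'
      · right
        exact ⟨by simp [h1, hdel h1], Or.inl hD⟩
      · by_cases h2 : S.HasDel c
        · left; simp [h1, h2]
        · right; exact ⟨by simp [h1, h2], Or.inl hD⟩
  · have hmem : e' ∈ c := by
      rcases Finset.mem_insert.1 he' with h | h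
      · exact absurd h hcase
      · exact Finset.mem_of_mem_erase h
    obtain rfl := heu e' hmem hde'
    have hne1 : e' ≠ Sym2.diag v := fun h => hde' (h ▸ dg_isDiag v)
    rw [Finset.erase_insert_of_ne (Ne.symm hcase)] at hface
    set R := (c.erase (Sym2.diag v)).erase e' with hR
    have hmem' : ∀ s, s ∈ c' ↔ s = Sym2.diag x ∨ s = S.eV v ∨ s ∈ R := by
      intro s; rw [hface]; simp only [Finset.mem_insert]
    have hRdiag : ∀ s ∈ R, s.IsDiag := by
      intro s hs
      rw [hR, Finset.mem_erase, Finset.mem_erase] at hs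
      by_contra hd
      exact hs.1 (heu s hs.2.2 hd)
    have hu' : ∀ s ∈ c', ¬ s.IsDiag → s = S.eV v := by
      intro s hs hd
      rcases (hmem' s).1 hs with rfl | rfl | h
      · exact absurd (dg_isDiag _) hd
      · rfl
      · exact absurd (hRdiag s h) hd
    have hdel' : ¬ S.HasDel c' := by
      rintro ⟨s, hs, h1, h2⟩
      rw [hu' s hs h1] at h2
      exact h2 (S.par_info hvr).1
    by_cases heT : e' ∈ S.T.edgeSet
    swap
    · left
      have : S.HasDel c := ⟨e', hmem, hde', heT⟩
      simp [this, hdel']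
    have hdel : ¬ S.HasDel c := by
      rintro ⟨s, hs, h1, h2⟩
      rw [heu s hs h1] at h2
      exact h2 heT
    right
    refine ⟨by simp [hdel, hdel'], ?_⟩
    obtain ⟨w, hw, rfl⟩ := S.tree_edge heT
    have hDR : S.Dsum (c.erase (Sym2.diag v)) = S.depth w + S.Dsum R := by
      rw [S.Dsum_erase (Finset.mem_erase.2 ⟨hne1, hmem⟩), S.hgt_eV hw]
    have hD' : S.Dsum c' ≤ S.depth x + S.depth v + S.Dsum R := by
      rw [hface]
      have h1 := S.Dsum_insert_le (Sym2.diag x) (insert (S.eV v) R)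
      have h2 := S.Dsum_insert_le (S.eV v) R
      rw [S.hgt_diag] at h1
      rw [S.hgt_eV hvr] at h2
      omega
    rcases S.mem_eV.1 hx with rfl | rfl
    swap
    · left
      have := (S.par_info hw).2
      omega
    have hDle : S.Dsum c' ≤ S.Dsum c := by omega
    rcases lt_or_eq_of_le hDle with hlt | heq
    · exact Or.inl hlt
    right
    refine ⟨heq, ?_⟩
    have hsmall' : S.HasSmall c' := by
      rw [hface]
      exact S.small_of_redundant hc hv hmin hw hmem heu hR (hface ▸ hdim') (hface ▸ hred')
    by_cases hsmall : S.HasSmall c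
    · right
      refine ⟨by simp [hsmall, hsmall'], ?_⟩
      obtain ⟨u, w', hu, hw', hew', hnle⟩ := hsmall
      obtain rfl := S.eV_inj hw' hw (heu _ hew' (S.eV_not_diag hw'))
      change S.topPos c' < S.topPos c
      rw [S.topPos_eq hvr ((hmem' _).2 (Or.inr (Or.inl rfl))) hu', S.topPos_eq hw hmem heu]
      exact lt_of_le_of_lt (S.pos_le (hmin u hu)) (S.pos_lt hnle)
    · left
      simp [hsmall, hsmall']

lemma gstep_wf (n : ℕ) : WellFounded (S.GStep n) :=
  Subrelation.wf (fun h => S.gstep_rk h) (InvImage.wf (S.rk n) wellFounded_lt)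

noncomputable def wt (n : ℕ) : Finset (Sym2 V) → ℕ :=
  (S.gstep_wf n).fix (fun c ih => 1 + ∑ c' : Finset (Sym2 V),
    if h : S.GStep n c' c then 3 * ih c' h else 0)

lemma wt_eq (n : ℕ) (c : Finset (Sym2 V)) : S.wt n c = 1 + ∑ c' : Finset (Sym2 V),
    if S.GStep n c' c then 3 * S.wt n c' else 0 := by
  unfold wt
  rw [WellFounded.fix_eq]
  simp

lemma wt_pos (n : ℕ) (c : Finset (Sym2 V)) : 0 < S.wt n c := by
  rw [wt_eq]; omega

lemma wt_step {n : ℕ} {c' c : Finset (Sym2 V)} (h : S.GStep n c' c) :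
    3 * S.wt n c' < S.wt n c := by
  rw [S.wt_eq n c]
  have := Finset.single_le_sum (f := fun c' => if S.GStep n c' c then 3 * S.wt n c' else 0)
    (fun _ _ => Nat.zero_le _) (Finset.mem_univ c')
  simp only [h, if_true] at this
  omega

end Cells

end Setup

section Rewriting

variable {V : Type}

lemma bar_bar (a : Finset (Sym2 V) × Bool) : bar (bar a) = a := by simp [bar]

lemma wordInv_wordInv (w : List (Finset (Sym2 V) × Bool)) : wordInv (wordInv w) = w := by
  unfold wordInv
  rw [List.map_reverse, List.reverse_reverse, List.map_map]
  conv_rhs => rw [← List.map_id w]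
  congr 1
  funext a
  exact bar_bar a

lemma wordInv_cons (a : Finset (Sym2 V) × Bool) (w : List (Finset (Sym2 V) × Bool)) :
    wordInv (a :: w) = wordInv w ++ [bar a] := by simp [wordInv]

variable [Fintype V] [DecidableEq V] (S : Setup V)

namespace Setup

lemma theEdge_spec {c : Finset (Sym2 V)} (h : dim c = 1) :
    S.theEdge c ∈ c ∧ ¬ (S.theEdge c).IsDiag := by
  obtain ⟨e, he, hd, -⟩ := edge_of_dim_one h
  have hne : (c.filter (fun s => ¬ s.IsDiag)).Nonempty := ⟨e, Finset.mem_filter.2 ⟨he, hd⟩⟩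
  have := hne.choose_spec
  unfold theEdge
  rw [dif_pos hne]
  exact Finset.mem_filter.1 this

lemma iota_tau (e : Sym2 V) : e = s(S.iota e, S.tau e) := by
  have h : s((Quot.out e).1, (Quot.out e).2) = e := Quot.out_eq e
  unfold iota tau
  split_ifs
  · rw [Sym2.eq_swap, h]
  · rw [h]

lemma src_bar (a : Finset (Sym2 V) × Bool) : S.src (bar a) = S.tgt a := by
  obtain ⟨c, b⟩ := a
  cases b <;> simp [src, tgt, bar]

lemma tgt_bar (a : Finset (Sym2 V) × Bool) : S.tgt (bar a) = S.src a := by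
  rw [← src_bar, bar_bar]

lemma insert_ne {n : ℕ} {f : Finset (Sym2 V)} (hf : S.IsCell n f) {e : Sym2 V} (he : e ∈ f)
    (hd : ¬ e.IsDiag) {x y : V} (hx : x ∈ e) (hxy : x ≠ y) :
    insert (Sym2.diag x) (f.erase e) ≠ insert (Sym2.diag y) (f.erase e) := by
  intro h
  have h1 : Sym2.diag x ∈ insert (Sym2.diag y) (f.erase e) := h ▸ Finset.mem_insert_self _ _
  rcases Finset.mem_insert.1 h1 with h2 | h2
  · exact hxy (dg_inj h2)
  · exact hf.2.2 _ (Finset.mem_of_mem_erase h2) e he (fun h => hd (h ▸ dg_isDiag x)) x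
      (mem_dg.2 rfl) hx

lemma orient_eq {n : ℕ} {a b : Finset (Sym2 V) × Bool} (hc : S.IsCell n a.1) (hd : dim a.1 = 1)
    (h1 : a.1 = b.1) (h2 : S.src a = S.src b) : a = b := by
  obtain ⟨c, p⟩ := a
  obtain ⟨c', q⟩ := b
  simp only at h1 hc hd
  subst h1
  obtain ⟨he, hdg⟩ := S.theEdge_spec hd
  have hit := S.iota_tau (S.theEdge c)
  have hne : S.iota (S.theEdge c) ≠ S.tau (S.theEdge c) := by
    intro h
    rw [hit, Sym2.mk_isDiag_iff] at hdg
    exact hdg h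
  have hi : S.iota (S.theEdge c) ∈ S.theEdge c := by
    have : S.iota (S.theEdge c) ∈ s(S.iota (S.theEdge c), S.tau (S.theEdge c)) := by simp
    rwa [← hit] at this
  have key := S.insert_ne hc he hdg hi hne
  cases p <;> cases q
  · rfl
  · exact absurd (by simpa [src] using h2.symm) key
  · exact absurd (by simpa [src] using h2) key
  · rfl

lemma src_form (a : Finset (Sym2 V) × Bool) : ∃ y, y ∈ S.theEdge a.1 ∧
    S.src a = insert (Sym2.diag y) (a.1.erase (S.theEdge a.1)) := by
  have hit := S.iota_tau (S.theEdge a.1)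
  refine ⟨if a.2 then S.iota (S.theEdge a.1) else S.tau (S.theEdge a.1), ?_, rfl⟩
  have h1 : ∀ z, z ∈ s(S.iota (S.theEdge a.1), S.tau (S.theEdge a.1)) → z ∈ S.theEdge a.1 := by
    intro z hz
    rwa [← hit] at hz
  apply h1
  split_ifs <;> simp

/-- `f` is the face of `σ` at the edge `e`, determined by the corner `Z`. -/
def FaceAt (σ f : Finset (Sym2 V)) (e : Sym2 V) (Z : Finset (Sym2 V)) : Prop :=
  e ∈ σ ∧ ¬ e.IsDiag ∧ ∃ x ∈ e, f = insert (Sym2.diag x) (σ.erase e) ∧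
    ∀ t ∈ e, Sym2.diag t ∈ Z ↔ t = x

lemma faceAt_unique {σ f f' : Finset (Sym2 V)} {e : Sym2 V} {Z : Finset (Sym2 V)}
    (h : FaceAt σ f e Z) (h' : FaceAt σ f' e Z) : f = f' := by
  obtain ⟨-, -, x, hx, rfl, h1⟩ := h
  obtain ⟨-, -, x', hx', rfl, h2⟩ := h'
  have := (h2 x hx).1 ((h1 x hx).2 rfl)
  rw [this]

lemma faceAt_src {n : ℕ} {σ : Finset (Sym2 V)} (hσ : S.IsCell n σ) {a : Finset (Sym2 V) × Bool}
    (hd : dim a.1 = 1) (hf : IsFace a.1 σ) : ∃ e, FaceAt σ a.1 e (S.src a) := by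
  obtain ⟨e, x, he, hed, hx, hfa⟩ := hf
  obtain ⟨y, hy, hs⟩ := S.src_form a
  obtain ⟨h1, h2⟩ := S.theEdge_spec hd
  generalize S.theEdge a.1 = e2 at *
  have he2 : e2 ∈ σ ∧ e2 ≠ e := by
    rw [hfa, Finset.mem_insert, Finset.mem_erase] at h1
    rcases h1 with rfl | h1
    · exact absurd (dg_isDiag _) h2
    · exact ⟨h1.2, h1.1⟩
  refine ⟨e, he, hed, x, hx, hfa, fun t ht => ?_⟩
  rw [hs, Finset.mem_insert, Finset.mem_erase]
  constructor
  · rintro (h | ⟨-, h⟩)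
    · have := dg_inj h
      subst this
      exact absurd ht (hσ.2.2 e2 he2.1 e he he2.2 t hy)
    · rw [hfa, Finset.mem_insert, Finset.mem_erase] at h
      rcases h with h | ⟨h3, h4⟩
      · exact dg_inj h
      · exact absurd ht (hσ.2.2 _ h4 e he h3 t (mem_dg.2 rfl))
  · rintro rfl
    right
    refine ⟨fun h => h2 (h ▸ dg_isDiag _), ?_⟩
    rw [hfa]
    exact Finset.mem_insert_self _ _

lemma third {n : ℕ} {σ : Finset (Sym2 V)} (hσ : S.IsCell n σ) (hd : dim σ = 2)
    {a b b' : Finset (Sym2 V) × Bool}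
    (ha : dim a.1 = 1) (hb : dim b.1 = 1) (hb' : dim b'.1 = 1)
    (fa : IsFace a.1 σ) (fb : IsFace b.1 σ) (fb' : IsFace b'.1 σ)
    (h1 : S.src a = S.src b) (h2 : S.src a = S.src b') (n1 : a.1 ≠ b.1) (n2 : a.1 ≠ b'.1) :
    b.1 = b'.1 := by
  obtain ⟨e1, g1⟩ := S.faceAt_src hσ ha fa
  obtain ⟨e2, g2⟩ := S.faceAt_src hσ hb fb
  obtain ⟨e3, g3⟩ := S.faceAt_src hσ hb' fb'
  rw [← h1] at g2
  rw [← h2] at g3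
  have k12 : e1 ≠ e2 := by
    rintro rfl
    exact n1 (faceAt_unique g1 g2)
  have k13 : e1 ≠ e3 := by
    rintro rfl
    exact n2 (faceAt_unique g1 g3)
  unfold dim at hd
  obtain ⟨p, q, -, hpq⟩ := Finset.card_eq_two.1 hd
  have mem : ∀ e f Z, FaceAt σ f e Z → e = p ∨ e = q := by
    intro e f Z h
    have : e ∈ σ.filter (fun s => ¬ s.IsDiag) := Finset.mem_filter.2 ⟨h.1, h.2.1⟩
    rw [hpq] at this
    simpa using this
  have : e2 = e3 := by
    rcases mem _ _ _ g1 with r1 | r1 <;> rcases mem _ _ _ g2 with r2 | r2 <;>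
      rcases mem _ _ _ g3 with r3 | r3 <;> simp_all
  subst this
  exact faceAt_unique g2 g3

lemma boundary_rev {n : ℕ} {σ : Finset (Sym2 V)} {a : Finset (Sym2 V) × Bool}
    {w : List (Finset (Sym2 V) × Bool)} (h : S.IsBoundaryWord n σ (a :: w)) :
    S.IsBoundaryWord n σ (bar a :: wordInv w) := by
  obtain ⟨a', b, c, d, hw, h1, h2, h3, h4, hnd, hcell, hface⟩ := h
  simp only [List.cons.injEq] at hw
  obtain ⟨rfl, rfl⟩ := hw
  refine ⟨bar a, bar d, bar c, bar b, by simp [wordInv], ?_, ?_, ?_, ?_, ?_, ?_, ?_⟩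
  · rw [tgt_bar, src_bar, h4]
  · rw [tgt_bar, src_bar, h3]
  · rw [tgt_bar, src_bar, h2]
  · rw [tgt_bar, src_bar, h1]
  · simp only [bar, List.nodup_cons, List.mem_cons, List.not_mem_nil, or_false, not_or,
      not_false_eq_true, List.nodup_nil, and_true] at hnd ⊢
    obtain ⟨⟨k1, k2, k3⟩, ⟨k4, k5⟩, k6⟩ := hnd
    exact ⟨⟨k3, k2, k1⟩, ⟨Ne.symm k6, Ne.symm k5⟩, Ne.symm k4⟩
  · intro x hx
    simp only [List.mem_cons, List.not_mem_nil, or_false] at hx hcell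
    rcases hx with rfl | rfl | rfl | rfl
    · exact hcell a (by simp)
    · exact hcell d (by simp)
    · exact hcell c (by simp)
    · exact hcell b (by simp)
  · intro c'
    rw [hface]
    simp only [bar, List.mem_cons, List.not_mem_nil, or_false]
    tauto

lemma boundary_unique {n : ℕ} {σ : Finset (Sym2 V)} (hσ : S.IsCell n σ) (hd : dim σ = 2)
    {a : Finset (Sym2 V) × Bool} {w w' : List (Finset (Sym2 V) × Bool)}
    (h : S.IsBoundaryWord n σ (a :: w)) (h' : S.IsBoundaryWord n σ (a :: w')) : w = w' := by
  obtain ⟨a1, b, c, d, hw, h1, h2, h3, h4, hnd, hcell, hface⟩ := h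
  simp only [List.cons.injEq] at hw
  obtain ⟨rfl, rfl⟩ := hw
  obtain ⟨a2, b', c', d', hw', h1', h2', h3', h4', hnd', hcell', hface'⟩ := h'
  simp only [List.cons.injEq] at hw'
  obtain ⟨rfl, rfl⟩ := hw'
  have fa : IsFace a.1 σ := (hface _).2 (by simp)
  have fb : IsFace b.1 σ := (hface _).2 (by simp)
  have fd : IsFace d.1 σ := (hface _).2 (by simp)
  have fb' : IsFace b'.1 σ := (hface' _).2 (by simp)
  have fc' : IsFace c'.1 σ := (hface' _).2 (by simp)
  have fd' : IsFace d'.1 σ := (hface' _).2 (by simp)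
  have ca := hcell a (by simp)
  have cb := hcell b (by simp)
  have cc := hcell c (by simp)
  have cd := hcell d (by simp)
  have cb' := hcell' b' (by simp)
  have cc' := hcell' c' (by simp)
  have cd' := hcell' d' (by simp)
  simp only [List.nodup_cons, List.mem_cons, List.not_mem_nil, or_false, not_or,
      not_false_eq_true, List.nodup_nil, and_true] at hnd hnd'
  obtain ⟨⟨k1, k2, k3⟩, ⟨k4, k5⟩, k6⟩ := hnd
  obtain ⟨⟨k1', k2', k3'⟩, ⟨k4', k5'⟩, k6'⟩ := hnd'
  have eb : b = b' := by
    apply S.orient_eq cb.1 cb.2 _ (h1.symm.trans h1')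
    exact S.third hσ hd (a := bar a) ca.2 cb.2 cb'.2 fa fb fb' (by rw [src_bar, h1])
      (by rw [src_bar, h1']) k1 k1'
  have ed : bar d = bar d' := by
    apply S.orient_eq (n := n) (a := bar d) (b := bar d') cd.1 cd.2 _ (by rw [src_bar, src_bar, h4, h4'])
    exact S.third hσ hd (a := a) (b := bar d) (b' := bar d') ca.2 cd.2 cd'.2 fa fd fd'
      (by rw [src_bar, h4]) (by rw [src_bar, h4']) k3 k3'
  have ed' : d = d' := by rw [← bar_bar d, ed, bar_bar]
  subst eb ed'
  have ec : c = c' := by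
    apply S.orient_eq cc.1 cc.2 _ (h2.symm.trans h2')
    have := (hface _).1 fc'
    simp only [List.mem_cons, List.not_mem_nil, or_false] at this
    rcases this with h | h | h | h
    · exact absurd h.symm k2'
    · exact absurd h.symm k4'
    · exact h.symm
    · exact absurd h k6'
  rw [ec]

lemma dim_redFrom {n : ℕ} {c : Finset (Sym2 V)} {v : V} (hv : S.Unblocked c v) :
    dim (S.redFrom c v) = dim c + 1 := by
  have hvr : v ≠ S.root := fun h => hv.2 (Or.inl h)
  have hevd := S.eV_not_diag hvr
  have hevc : S.eV v ∉ c := by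
    intro h
    exact hv.2 (Or.inr ⟨_, h, (fun h' => hevd (h' ▸ dg_isDiag v)), v,
      (S.mem_eV.2 (Or.inl rfl)), (S.mem_eV.2 (Or.inl rfl))⟩)
  unfold dim redFrom
  rw [Finset.filter_insert, if_pos hevd, Finset.card_insert_of_notMem, Finset.filter_erase,
    Finset.erase_eq_of_notMem]
  · simp
  · intro h
    exact hevc (Finset.mem_of_mem_erase (Finset.mem_of_mem_filter _ h))

lemma not_red_of_coll {n : ℕ} {c : Finset (Sym2 V)} (hd : dim c = 1) (h : S.Collapsible n c) :
    ¬ S.Redundant n c := by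
  obtain ⟨c₀, hc₀, hr₀, v, hv, hmin, rfl⟩ := h
  rw [S.dim_redFrom (n := n) hv] at hd
  have hd0 : dim c₀ = 0 := by omega
  intro h
  unfold Redundant at h hr₀
  rw [S.dim_redFrom (n := n) hv, hd0] at h
  rw [hd0] at hr₀
  exact h.2 ⟨c₀, hc₀, hd0, hr₀, v, hv, hmin, rfl⟩

lemma principal_unique {c σ σ' : Finset (Sym2 V)} (h : S.PrincipalRedOf c σ)
    (h' : S.PrincipalRedOf c σ') : σ = σ' := by
  obtain ⟨v, hv, hm, rfl⟩ := h
  obtain ⟨v', hv', hm', rfl⟩ := h'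
  rw [S.vle_antisymm (hm v' hv') (hm' v hv)]

end Setup

/-- Normal form of a relation with a one-letter left side. -/
inductive Single (n : ℕ) (a : Finset (Sym2 V) × Bool) : List (Finset (Sym2 V) × Bool) → Prop
  | coll (h1 : S.IsCell n a.1) (h2 : Setup.dim a.1 = 1) (h3 : S.Collapsible n a.1) : Single n a []
  | sq (σ : Finset (Sym2 V))
      (w : List (Finset (Sym2 V) × Bool)) (hσ : S.IsCell n σ) (hd : Setup.dim σ = 2)
      (hc₀ : S.IsCell n a.1) (hred : S.Redundant n a.1) (hW : S.PrincipalRedOf a.1 σ)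
      (hbw : S.IsBoundaryWord n σ (a :: w)) (hno : ∀ x ∈ w, x.1 ≠ a.1) :
      Single n a (wordInv w)

lemma wordInv_no {w : List (Finset (Sym2 V) × Bool)} {c : Finset (Sym2 V)}
    (h : ∀ x ∈ w, x.1 ≠ c) : ∀ x ∈ wordInv w, x.1 ≠ c := by
  intro x hx
  simp only [wordInv, List.mem_reverse, List.mem_map] at hx
  obtain ⟨y, hy, rfl⟩ := hx
  exact h y hy

lemma rel_cases {n : ℕ} {l r : List (Finset (Sym2 V) × Bool)} (h : MPRel S n l r) :
    (∃ a, l = [a] ∧ Single S n a r) ∨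
    (∃ a, l = [a, bar a] ∧ r = [] ∧ S.IsCell n a.1 ∧ Setup.dim a.1 = 1) := by
  cases h with
  | collapse a h1 h2 h3 => exact Or.inl ⟨a, rfl, .coll h1 h2 h3⟩
  | cancel a h1 h2 => exact Or.inr ⟨a, rfl, rfl, h1, h2⟩
  | square σ c₀ a w hσ hd hc₀ hred hW ha hbw hno =>
    subst ha
    exact Or.inl ⟨a, rfl, .sq σ w hσ hd hc₀ hred hW hbw hno⟩
  | squareInv σ c₀ a w hσ hd hc₀ hred hW ha hbw hno =>
    subst ha
    refine Or.inl ⟨bar a, rfl, ?_⟩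
    rw [← wordInv_wordInv r]
    exact .sq σ (wordInv r) hσ hd hc₀ hred hW (S.boundary_rev hbw) (wordInv_no hno)

lemma single_rel {n : ℕ} {a : Finset (Sym2 V) × Bool} {r : List (Finset (Sym2 V) × Bool)}
    (h : Single S n a r) : MPRel S n [a] r := by
  cases h with
  | coll h1 h2 h3 => exact .collapse a h1 h2 h3
  | sq σ w hσ hd hc₀ hred hW hbw hno => exact .square σ a.1 a w hσ hd hc₀ hred hW rfl hbw hno

lemma single_bar {n : ℕ} {a : Finset (Sym2 V) × Bool} {r : List (Finset (Sym2 V) × Bool)}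
    (h : Single S n a r) : Single S n (bar a) (wordInv r) := by
  cases h with
  | coll h1 h2 h3 => exact .coll h1 h2 h3
  | sq σ w hσ hd hc₀ hred hW hbw hno =>
    exact .sq σ (wordInv w) hσ hd hc₀ hred hW (S.boundary_rev hbw) (wordInv_no hno)

lemma single_det {n : ℕ} {a : Finset (Sym2 V) × Bool} {r r' : List (Finset (Sym2 V) × Bool)}
    (h : Single S n a r) (h' : Single S n a r') : r = r' := by
  have bd : ∀ σ w, S.IsBoundaryWord n σ (a :: w) → Setup.dim a.1 = 1 := by
    rintro σ w ⟨a', b, c, d, hw, -, -, -, -, -, hcell, -⟩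
    simp only [List.cons.injEq] at hw
    obtain ⟨rfl, -⟩ := hw
    exact (hcell a (by simp)).2
  cases h with
  | coll h1 h2 h3 =>
    cases h' with
    | coll => rfl
    | sq σ w hσ hd hc₀ hred hW hbw hno => exact absurd hred (S.not_red_of_coll h2 h3)
  | sq σ w hσ hd hc₀ hred hW hbw hno =>
    cases h' with
    | coll h1 h2 h3 => exact absurd hred (S.not_red_of_coll h2 h3)
    | sq σ' w' hσ' hd' hc₀' hred' hW' hbw' hno' =>
      obtain rfl := S.principal_unique hW hW'
      rw [S.boundary_unique hσ hd hbw hbw']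

lemma single_cells {n : ℕ} {a : Finset (Sym2 V) × Bool} {r : List (Finset (Sym2 V) × Bool)}
    (h : Single S n a r) : ∀ x ∈ r, S.IsCell n x.1 ∧ Setup.dim x.1 = 1 := by
  cases h with
  | coll => simp
  | sq σ w hσ hd hc₀ hred hW hbw hno =>
    obtain ⟨a', b, c, d, hw, -, -, -, -, -, hcell, -⟩ := hbw
    intro x hx
    simp only [wordInv, List.mem_reverse, List.mem_map] at hx
    obtain ⟨y, hy, rfl⟩ := hx
    exact hcell y (hw ▸ List.mem_cons_of_mem _ hy)

/-- Weight of a word. -/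
noncomputable def wordWt (n : ℕ) (w : List (Finset (Sym2 V) × Bool)) : ℕ :=
  (w.map (fun a => S.wt n a.1)).sum

lemma rel_wt {n : ℕ} {l r : List (Finset (Sym2 V) × Bool)} (h : MPRel S n l r) :
    wordWt S n r < wordWt S n l := by
  rcases rel_cases S h with ⟨a, rfl, hs⟩ | ⟨a, rfl, rfl, -⟩
  · have hp := S.wt_pos n a.1
    cases hs with
    | coll => simpa [wordWt] using hp
    | sq σ w hσ hd hc₀ hred hW hbw hno =>
      obtain ⟨a', b, c, d, hw, -, -, -, -, -, hcell, hface⟩ := hbw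
      simp only [List.cons.injEq] at hw
      obtain ⟨rfl, rfl⟩ := hw
      have key : ∀ x ∈ [b, c, d], 3 * S.wt n x.1 < S.wt n a.1 := by
        intro x hx
        apply S.wt_step
        have hx' : x ∈ [a, b, c, d] := List.mem_cons_of_mem _ hx
        refine ⟨hc₀, (hcell a (by simp)).2, hred, σ, hW, (hface _).2 ?_, hno x hx, hcell x hx'⟩
        have := List.mem_map_of_mem (f := Prod.fst) hx'
        simpa using this
      have hb := key b (by simp)
      have hc := key c (by simp)
      have hd := key d (by simp)
      simp [wordWt, wordInv, bar]
      omega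
  · have hp := S.wt_pos n a.1
    simp [wordWt, bar]
    omega

lemma move_wt {n : ℕ} {x y : List (Finset (Sym2 V) × Bool)} (h : MPMove S n x y) :
    wordWt S n y < wordWt S n x := by
  obtain ⟨u, v, l, r, h, rfl, rfl⟩ := h
  have := rel_wt S h
  simp only [wordWt, List.map_append, List.sum_append] at *
  omega

abbrev Red (n : ℕ) := Relation.ReflTransGen (MPMove S n)

lemma move_ctx {n : ℕ} (u v : List (Finset (Sym2 V) × Bool)) {x y : List (Finset (Sym2 V) × Bool)}
    (h : MPMove S n x y) : MPMove S n (u ++ x ++ v) (u ++ y ++ v) := by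
  obtain ⟨u', v', l, r, h, rfl, rfl⟩ := h
  exact ⟨u ++ u', v' ++ v, l, r, h, by simp, by simp⟩

lemma red_ctx {n : ℕ} (u v : List (Finset (Sym2 V) × Bool)) {x y : List (Finset (Sym2 V) × Bool)}
    (h : Red S n x y) : Red S n (u ++ x ++ v) (u ++ y ++ v) := by
  induction h with
  | refl => exact .refl
  | tail _ h ih => exact ih.tail (move_ctx S u v h)

lemma red_rel {n : ℕ} (u v : List (Finset (Sym2 V) × Bool)) {l r : List (Finset (Sym2 V) × Bool)}
    (h : MPRel S n l r) : Red S n (u ++ l ++ v) (u ++ r ++ v) :=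
  .single ⟨u, v, l, r, h, rfl, rfl⟩

lemma red_inv {n : ℕ} (w : List (Finset (Sym2 V) × Bool))
    (h : ∀ x ∈ w, S.IsCell n x.1 ∧ Setup.dim x.1 = 1) : Red S n (w ++ wordInv w) [] := by
  induction w with
  | nil => exact .refl
  | cons a w ih =>
    have h1 := red_ctx S [a] [bar a] (ih (fun x hx => h x (List.mem_cons_of_mem _ hx)))
    have h2 := red_rel S [] [] (MPRel.cancel a (h a (by simp)).1 (h a (by simp)).2)
    rw [wordInv_cons]
    refine Relation.ReflTransGen.trans ?_ h2
    simpa using h1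

/-- Joinability. -/
def Join (n : ℕ) (y z : List (Finset (Sym2 V) × Bool)) : Prop :=
  ∃ w, Red S n y w ∧ Red S n z w

lemma Join.symm {n : ℕ} {y z : List (Finset (Sym2 V) × Bool)} (h : Join S n y z) : Join S n z y := by
  obtain ⟨w, h1, h2⟩ := h
  exact ⟨w, h2, h1⟩

lemma Join.ctx {n : ℕ} (u v : List (Finset (Sym2 V) × Bool)) {y z : List (Finset (Sym2 V) × Bool)}
    (h : Join S n y z) : Join S n (u ++ y ++ v) (u ++ z ++ v) := by
  obtain ⟨w, h1, h2⟩ := h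
  exact ⟨_, red_ctx S u v h1, red_ctx S u v h2⟩

/-- Overlap of a cancellation and a one-letter rule on its first letter. -/
lemma join_first {n : ℕ} {a : Finset (Sym2 V) × Bool} {r : List (Finset (Sym2 V) × Bool)}
    (h : Single S n a r) : Join S n (r ++ [bar a]) [] := by
  refine ⟨[], ?_, .refl⟩
  have h1 := red_rel S r [] (single_rel S (single_bar S h))
  have h2 := red_inv S r (single_cells S h)
  refine Relation.ReflTransGen.trans ?_ h2
  simpa using h1

lemma join_second {n : ℕ} {a : Finset (Sym2 V) × Bool} {r : List (Finset (Sym2 V) × Bool)}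
    (h : Single S n (bar a) r) : Join S n ([a] ++ r) [] := by
  refine ⟨[], ?_, .refl⟩
  have h0 := single_bar S h
  rw [bar_bar] at h0
  have h1 := red_rel S [] r (single_rel S h0)
  have h2 := red_inv S (wordInv r) (single_cells S h0)
  rw [wordInv_wordInv] at h2
  exact Relation.ReflTransGen.trans (by simpa using h1) h2

lemma disjoint_join {n : ℕ} {u t v l r l' r' : List (Finset (Sym2 V) × Bool)}
    (h : MPRel S n l r) (h' : MPRel S n l' r') :
    Join S n (u ++ r ++ (t ++ l' ++ v)) ((u ++ l ++ t) ++ r' ++ v) := by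
  refine ⟨u ++ r ++ t ++ r' ++ v, ?_, ?_⟩
  · have := red_rel S (u ++ r ++ t) v h'
    simpa using this
  · have := red_rel S u (t ++ r' ++ v) h
    simpa using this

/-- Local confluence when the first rule applies no later than the second. -/
lemma local_aux {n : ℕ} {t v v' l r l' r' : List (Finset (Sym2 V) × Bool)}
    (h : MPRel S n l r) (h' : MPRel S n l' r') (he : l ++ v = t ++ l' ++ v') :
    Join S n (r ++ v) (t ++ r' ++ v') := by
  have h0 := h
  have h0' := h'
  rcases rel_cases S h with ⟨a, rfl, hs⟩ | ⟨a, rfl, rfl, hc, hd⟩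
  · cases t with
    | nil =>
      rcases rel_cases S h' with ⟨b, rfl, hs'⟩ | ⟨b, rfl, rfl, hc', hd'⟩
      · simp only [List.cons_append, List.nil_append, List.cons.injEq] at he
        obtain ⟨rfl, rfl⟩ := he
        rw [single_det S hs hs']
        exact ⟨_, .refl, .refl⟩
      · simp only [List.cons_append, List.nil_append, List.cons.injEq] at he
        obtain ⟨rfl, rfl⟩ := he
        simpa using Join.ctx S [] v' (join_first S hs)
    | cons x t =>
      simp only [List.cons_append, List.nil_append, List.cons.injEq] at he
      obtain ⟨rfl, rfl⟩ := he
      simpa using disjoint_join S (u := []) (t := t) (v := v') h0 h0'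
  · rcases t with _ | ⟨x, _ | ⟨y, t⟩⟩
    · rcases rel_cases S h' with ⟨b, rfl, hs'⟩ | ⟨b, rfl, rfl, hc', hd'⟩
      · simp only [List.cons_append, List.nil_append, List.cons.injEq] at he
        obtain ⟨rfl, rfl⟩ := he
        simpa using (Join.ctx S [] v (join_first S hs')).symm
      · simp only [List.cons_append, List.nil_append, List.cons.injEq] at he
        obtain ⟨rfl, -, rfl⟩ := he
        exact ⟨_, .refl, .refl⟩
    · rcases rel_cases S h' with ⟨b, rfl, hs'⟩ | ⟨b, rfl, rfl, hc', hd'⟩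
      · simp only [List.cons_append, List.nil_append, List.cons.injEq] at he
        obtain ⟨rfl, rfl, rfl⟩ := he
        simpa using (Join.ctx S [] v (join_second S hs')).symm
      · simp only [List.cons_append, List.nil_append, List.cons.injEq] at he
        obtain ⟨rfl, rfl, rfl⟩ := he
        rw [bar_bar]
        exact ⟨_, .refl, by simpa using Relation.ReflTransGen.refl⟩
    · simp only [List.cons_append, List.nil_append, List.cons.injEq] at he
      obtain ⟨rfl, rfl, rfl⟩ := he
      simpa using disjoint_join S (u := []) (t := t) (v := v') h0 h0'

lemma local_confl {n : ℕ} {x y z : List (Finset (Sym2 V) × Bool)}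
    (h : MPMove S n x y) (h' : MPMove S n x z) : Join S n y z := by
  obtain ⟨u, v, l, r, hr, rfl, rfl⟩ := h
  obtain ⟨u', v', l', r', hr', he, rfl⟩ := h'
  rw [List.append_assoc, List.append_assoc, List.append_eq_append_iff] at he
  rcases he with ⟨t, rfl, h2⟩ | ⟨t, rfl, h2⟩
  · have := local_aux S (t := t) (v' := v') hr hr' (by rw [h2]; simp)
    simpa using Join.ctx S u [] this
  · have := local_aux S (t := t) (v' := v) hr' hr (by rw [h2]; simp)
    simpa using (Join.ctx S u' [] this).symm

lemma newman {n : ℕ} (k : ℕ) : ∀ x y z : List (Finset (Sym2 V) × Bool), wordWt S n x = k →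
    Red S n x y → Red S n x z → Join S n y z := by
  induction k using Nat.strong_induction_on with
  | _ k ih =>
    intro x y z hk hy hz
    rcases hy.cases_head with rfl | ⟨y1, hy1, hy⟩
    · exact ⟨z, hz, .refl⟩
    rcases hz.cases_head with rfl | ⟨z1, hz1, hz⟩
    · exact ⟨y, .refl, .head hy1 hy⟩
    obtain ⟨w, a1, a2⟩ := local_confl S hy1 hz1
    have k1 := move_wt S hy1
    have k2 := move_wt S hz1
    obtain ⟨p, b1, b2⟩ := ih _ (hk ▸ k1) y1 y w rfl hy a1
    obtain ⟨q, c1, c2⟩ := ih _ (hk ▸ k2) z1 p z rfl (a2.trans b2) hz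
    exact ⟨q, b1.trans c1, c2⟩

end Rewriting

/-- The string rewriting system associated to the monoid presentation `MP_W` is complete:
terminating and confluent. -/
theorem stmt16 {V : Type} [Fintype V] [DecidableEq V] (S : Setup V) (n : ℕ) (hn : 1 ≤ n) (hsub : S.SuffSubdiv n) :
    (¬ ∃ f : ℕ → List (Finset (Sym2 V) × Bool), ∀ i : ℕ, MPMove S n (f i) (f (i + 1))) ∧
    (∀ x y z : List (Finset (Sym2 V) × Bool),
      Relation.ReflTransGen (MPMove S n) x y → Relation.ReflTransGen (MPMove S n) x z →
      ∃ w : List (Finset (Sym2 V) × Bool),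
        Relation.ReflTransGen (MPMove S n) y w ∧ Relation.ReflTransGen (MPMove S n) z w) := by
  refine ⟨?_, ?_⟩
  · rintro ⟨f, hf⟩
    have key : ∀ i : ℕ, wordWt S n (f i) + i ≤ wordWt S n (f 0) := by
      intro i
      induction i with
      | zero => simp
      | succ i ih =>
        have := move_wt S (hf i)
        omega
    have := key (wordWt S n (f 0) + 1)
    omega
  · intro x y z hy hz
    exact newman S _ x y z rfl hy hz


end GraphBraid
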